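/- Proposition: If A and B ∈ ARI(Γ) are pus-neutral moulds, then ari_v(A,B) is pus-neutral. -/

import Mathlib

namespace KVMould

/-- A mould over `Γ` in evaluation form: the depth-`m` component
`M m σ x` is the value of the rational function `M^m_{σ₁,…,σₘ}` at the
rational point `x = (x₁,…,xₘ)` (indices are 0-based). -/
abbrev Mould (Γ : Type) : Type := (m : ℕ) → (Fin m → Γ) → (Fin m → ℚ) → ℚ

variable {Γ : Type} [CommGroup Γ]

/-- `M ∈ ARI(Γ)`: the depth `0` component vanishes. -/
def IsARI (M : Mould Γ) : Prop := ∀ σ x, M 0 σ x = 0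

/-- Extension of a tuple of rationals by `0` outside the range. -/
def extQ {m : ℕ} (x : Fin m → ℚ) : ℕ → ℚ := fun i => if h : i < m then x ⟨i, h⟩ else 0

/-- Extension of a tuple of group elements by `1` outside the range. -/
def extG {m : ℕ} (σ : Fin m → Γ) : ℕ → Γ := fun i => if h : i < m then σ ⟨i, h⟩ else 1

/-- The (noncommutative, nonunital on `ARI`) mould product `A × B`. -/
def mouldMul (A B : Mould Γ) : Mould Γ := fun m σ x =>
  ∑ k ∈ Finset.range (m + 1),
    A k (fun j => extG σ j.val) (fun j => extQ x j.val) *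
      B (m - k) (fun j => extG σ (k + j.val)) (fun j => extQ x (k + j.val))

/-- Ecalle's derivation `arit_u(B)(A)` (0-indexed form of the paper's
Definition of `arit_u`; the blocks `k ≤ l` below are 0-based). -/
def aritU (B A : Mould Γ) : Mould Γ := fun m σ x =>
  (∑ k ∈ Finset.range m, ∑ l ∈ Finset.range m,
    if k ≤ l ∧ l + 1 < m then
      A (m - (l - k + 1))
        (fun j => if j.val < k then extG σ j.val
          else if j.val = k then extG σ (l + 1)
          else extG σ (j.val + (l - k + 1)))
        (fun j => if j.val < k then extQ x j.val
          else if j.val = k then ∑ i ∈ Finset.Icc k (l + 1), extQ x i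
          else extQ x (j.val + (l - k + 1))) *
      B (l - k + 1)
        (fun j => extG σ (k + j.val) * (extG σ (l + 1))⁻¹)
        (fun j => extQ x (k + j.val))
    else 0)
  -
  (∑ k ∈ Finset.range m, ∑ l ∈ Finset.range m,
    if 1 ≤ k ∧ k ≤ l then
      A (m - (l - k + 1))
        (fun j => if j.val < k - 1 then extG σ j.val
          else if j.val = k - 1 then extG σ (k - 1)
          else extG σ (j.val + (l - k + 1)))
        (fun j => if j.val < k - 1 then extQ x j.val
          else if j.val = k - 1 then ∑ i ∈ Finset.Icc (k - 1) l, extQ x i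
          else extQ x (j.val + (l - k + 1))) *
      B (l - k + 1)
        (fun j => extG σ (k + j.val) * (extG σ (k - 1))⁻¹)
        (fun j => extQ x (k + j.val))
    else 0)

/-- The `ari_u`-bracket: `ari_u(A,B) = arit_u(B)(A) − arit_u(A)(B) + A×B − B×A`. -/
def ariU (A B : Mould Γ) : Mould Γ :=
  aritU B A - aritU A B + mouldMul A B - mouldMul B A

/-- `preari_u(A,B) = arit_u(B)(A) + A×B`. -/
def preariU (A B : Mould Γ) : Mould Γ := aritU B A + mouldMul A B

/-- The set of shuffle permutations `Sh(p,q)`. -/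
def shuffles (p q : ℕ) : Finset (Equiv.Perm (Fin (p + q))) :=
  Finset.univ.filter fun τ =>
    (∀ i j : Fin (p + q), i.val < j.val → j.val < p → τ⁻¹ i < τ⁻¹ j) ∧
    (∀ i j : Fin (p + q), i.val < j.val → p ≤ i.val → τ⁻¹ i < τ⁻¹ j)

/-- Alternality of a mould. -/
def IsAlternal (M : Mould Γ) : Prop :=
  ∀ p q : ℕ, 1 ≤ p → 1 ≤ q → ∀ (σ : Fin (p + q) → Γ) (x : Fin (p + q) → ℚ),
    ∑ τ ∈ shuffles p q, M (p + q) (fun i => σ (τ i)) (fun i => x (τ i)) = 0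

/-- The `swap` of a mould. -/
def swapM (M : Mould Γ) : Mould Γ := fun m σ v =>
  M m (fun i => ∏ j ∈ Finset.range (m - i.val), extG σ j)
    (fun i => extQ v (m - 1 - i.val) - extQ v (m - i.val))

/-- Bialternality: `M` and `swap(M)` are alternal and the depth `1`
component is even (`M¹(x₁;σ₁) = M¹(−x₁;σ₁⁻¹)`). -/
def IsBialternal (M : Mould Γ) : Prop :=
  IsAlternal M ∧ IsAlternal (swapM M) ∧
    ∀ (σ : Γ) (t : ℚ), M 1 (fun _ => σ) (fun _ => t) = M 1 (fun _ => σ⁻¹) (fun _ => -t)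

/-- The `push` operator. -/
def pushM (M : Mould Γ) : Mould Γ := fun m σ x =>
  M m
    (fun i => if i.val = 0 then (extG σ (m - 1))⁻¹
      else extG σ (i.val - 1) * (extG σ (m - 1))⁻¹)
    (fun i => if i.val = 0 then -(∑ j ∈ Finset.range m, extQ x j)
      else extQ x (i.val - 1))

/-- The `v`-variant `arit_v(B)(A)`. -/
def aritV (B A : Mould Γ) : Mould Γ := fun m σ v =>
  (∑ k ∈ Finset.range m, ∑ l ∈ Finset.range m,
    if k ≤ l ∧ l + 1 < m then
      A (m - (l - k + 1))
        (fun j => if j.val < k then extG σ j.val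
          else if j.val = k then ∏ i ∈ Finset.Icc k (l + 1), extG σ i
          else extG σ (j.val + (l - k + 1)))
        (fun j => if j.val < k then extQ v j.val
          else if j.val = k then extQ v (l + 1)
          else extQ v (j.val + (l - k + 1))) *
      B (l - k + 1)
        (fun j => extG σ (k + j.val))
        (fun j => extQ v (k + j.val) - extQ v (l + 1))
    else 0)
  -
  (∑ k ∈ Finset.range m, ∑ l ∈ Finset.range m,
    if 1 ≤ k ∧ k ≤ l then
      A (m - (l - k + 1))
        (fun j => if j.val < k - 1 then extG σ j.val
          else if j.val = k - 1 then ∏ i ∈ Finset.Icc (k - 1) l, extG σ i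
          else extG σ (j.val + (l - k + 1)))
        (fun j => if j.val < k - 1 then extQ v j.val
          else if j.val = k - 1 then extQ v (k - 1)
          else extQ v (j.val + (l - k + 1))) *
      B (l - k + 1)
        (fun j => extG σ (k + j.val))
        (fun j => extQ v (k + j.val) - extQ v (k - 1))
    else 0)

/-- The `ari_v`-bracket. -/
def ariV (A B : Mould Γ) : Mould Γ :=
  aritV B A - aritV A B + mouldMul A B - mouldMul B A

/-- Pus-neutrality: all cyclic shifts of every component sum to zero. -/
def IsPusNeutral (N : Mould Γ) : Prop :=
  ∀ m : ℕ, 1 ≤ m → ∀ (σ : Fin m → Γ) (v : Fin m → ℚ),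
    ∑ i ∈ Finset.range m,
      N m (fun j => extG σ ((i + j.val) % m)) (fun j => extQ v ((i + j.val) % m)) = 0

/-- The subgroup `Γ^N = {g^N : g ∈ Γ}`. -/
def powSubgroup (Γ : Type) [CommGroup Γ] (N : ℕ) : Subgroup Γ :=
  MonoidHom.range (powMonoidHom N)

/-- The map `i_N : ARI(Γ) → ARI(Γ^N)` (restriction of indices). -/
def iN (N : ℕ) (M : Mould Γ) : Mould (powSubgroup Γ N) := fun m σ x =>
  M m (fun i => (σ i : Γ)) x

/-- The map `m_N : ARI(Γ) → ARI(Γ^N)`. -/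
def mN [Fintype Γ] [DecidableEq Γ] (N : ℕ) (M : Mould Γ) :
    Mould (powSubgroup Γ N) := fun m σ x =>
  ∑ τ ∈ Finset.univ.filter (fun τ : Fin m → Γ => ∀ i, τ i ^ N = (σ i : Γ)),
    M m τ (fun i => (N : ℚ) * x i)

/-- `M` satisfies the distribution relations. -/
def IsARID [Fintype Γ] [DecidableEq Γ] (M : Mould Γ) : Prop :=
  ∀ N : ℕ, 1 ≤ N → N ∣ Fintype.card Γ → iN N M = mN N M

/-- The parallel translation map `t`. -/
def tMap (P : Mould Γ) : Mould Γ := fun m σ v =>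
  if m ≤ 1 then P m σ v
  else P (m - 1) (fun j => extG σ (j.val + 1)) (fun j => extQ v (j.val + 1) - extQ v 0)

/-- `ũ := t ∘ swap`. -/
def uTilde (M : Mould Γ) : Mould Γ := tMap (swapM M)

/-- Translating the index of summation over a full period does not change the sum. -/
theorem sum_range_add_of_periodic {f : ℕ → ℚ} {m : ℕ} (hf : Function.Periodic f m) (a : ℕ) :
    ∑ i ∈ Finset.range m, f (i + a) = ∑ i ∈ Finset.range m, f i := by
  induction a with
  | zero => rfl
  | succ a ih =>
    rw [← ih]
    have h := Finset.sum_range_succ (fun i => f (i + a)) m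
    rw [Finset.sum_range_succ'] at h
    have hm : f (m + a) = f (0 + a) := by rw [add_comm m a, hf, zero_add]
    simp only [hm, add_left_inj] at h
    rw [← h]
    exact Finset.sum_congr rfl fun i _ => by congr 1; omega

/-- A sum over intervals `[k, l]` in `{0, …, m - 1}` with `l + 1 < m`, sorted by the length. -/
theorem sum_intervals_init (m : ℕ) (F : ℕ → ℕ → ℚ) :
    (∑ k ∈ Finset.range m, ∑ l ∈ Finset.range m, if k ≤ l ∧ l + 1 < m then F k l else 0) =
      ∑ d ∈ Finset.range (m - 1), ∑ k ∈ Finset.range (m - (d + 1)), F k (k + d) := by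
  rw [← Finset.sum_product', ← Finset.sum_filter, Finset.sum_sigma']
  refine Finset.sum_nbij' (fun q => ⟨q.2 - q.1, q.1⟩) (fun q => (q.2, q.2 + q.1)) ?_ ?_ ?_ ?_ ?_
  · rintro ⟨k, l⟩ h
    simp only [Finset.mem_filter, Finset.mem_product, Finset.mem_sigma, Finset.mem_range] at h ⊢
    omega
  · rintro ⟨d, k⟩ h
    simp only [Finset.mem_filter, Finset.mem_product, Finset.mem_sigma, Finset.mem_range] at h ⊢
    omega
  · rintro ⟨k, l⟩ h
    simp only [Finset.mem_filter, Finset.mem_product, Finset.mem_range, Prod.mk.injEq, true_and] at h ⊢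
    omega
  · rintro ⟨d, k⟩ -
    simp
  · rintro ⟨k, l⟩ h
    simp only [Finset.mem_filter, Finset.mem_product, Finset.mem_range] at h
    simp only [show k + (l - k) = l by omega]

/-- A sum over intervals `[k, l]` in `{0, …, m - 1}` with `1 ≤ k`, sorted by the length. -/
theorem sum_intervals_tail (m : ℕ) (F : ℕ → ℕ → ℚ) :
    (∑ k ∈ Finset.range m, ∑ l ∈ Finset.range m, if 1 ≤ k ∧ k ≤ l then F k l else 0) =
      ∑ d ∈ Finset.range (m - 1), ∑ k ∈ Finset.range (m - (d + 1)), F (k + 1) (k + 1 + d) := by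
  rw [← Finset.sum_product', ← Finset.sum_filter, Finset.sum_sigma']
  refine Finset.sum_nbij' (fun q => ⟨q.2 - q.1, q.1 - 1⟩) (fun q => (q.2 + 1, q.2 + 1 + q.1))
    ?_ ?_ ?_ ?_ ?_
  · rintro ⟨k, l⟩ h
    simp only [Finset.mem_filter, Finset.mem_product, Finset.mem_sigma, Finset.mem_range] at h ⊢
    omega
  · rintro ⟨d, k⟩ h
    simp only [Finset.mem_filter, Finset.mem_product, Finset.mem_sigma, Finset.mem_range] at h ⊢
    omega
  · rintro ⟨k, l⟩ h
    simp only [Finset.mem_filter, Finset.mem_product, Finset.mem_range, Prod.mk.injEq] at h ⊢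
    omega
  · rintro ⟨d, k⟩ -
    simp
  · rintro ⟨k, l⟩ h
    simp only [Finset.mem_filter, Finset.mem_product, Finset.mem_range] at h ⊢
    congr 1 <;> omega

/-- The sequence `y` with the `d + 2` consecutive entries from position `k` on replaced by `c`. -/
def contract {X : Type} (k d : ℕ) (y : ℕ → X) (c : X) : ℕ → X := fun j =>
  if j < k then y j else if j = k then c else y (j + (d + 1))

/-- Contractions of the rotations of a periodic sequence at a fixed cyclic block are the
rotations of a single sequence. -/
theorem contract_rotate {X : Type} {y : ℕ → X} {m n d k j : ℕ} (hy : Function.Periodic y m)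
    (hm : m = n + (d + 1)) (hk : k < n) (hj : j < n) (a : ℕ) (c : X) :
    contract k d (fun t => y (a + (m - k) + t)) c j =
      if (n - k + j) % n = 0 then c else y (a + (d + 1) + (n - k + j) % n) := by
  unfold contract
  rcases lt_trichotomy j k with h | h | h
  · have e : (n - k + j) % n = n - k + j := Nat.mod_eq_of_lt (by omega)
    rw [if_pos h, e, if_neg (by omega)]
    beta_reduce
    congr 1
    omega
  · have e : (n - k + j) % n = 0 := by
      rw [show n - k + j = n by omega, Nat.mod_self]
    rw [if_neg (by omega), if_pos h, if_pos e]
  · have e : (n - k + j) % n = j - k := by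
      rw [show n - k + j = j - k + n by omega, Nat.add_mod_right, Nat.mod_eq_of_lt (by omega)]
    rw [if_neg (by omega), if_neg (by omega), e, if_neg (by omega), ← hy (a + (d + 1) + (j - k))]
    beta_reduce
    congr 1
    omega

theorem extQ_apply {m : ℕ} (x : ℕ → ℚ) {a : ℕ} (h : a < m) :
    extQ (fun j : Fin m => x j.val) a = x a := by
  simp [extQ, h]

theorem extG_apply {m : ℕ} (s : ℕ → Γ) {a : ℕ} (h : a < m) :
    extG (fun j : Fin m => s j.val) a = s a := by
  simp [extG, h]

/-- Pus-neutrality in terms of sequences indexed by `ℕ`. -/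
theorem IsPusNeutral.sum_eq_zero {A : Mould Γ} (hA : IsPusNeutral A) {n : ℕ} (hn : 1 ≤ n)
    (s : ℕ → Γ) (x : ℕ → ℚ) :
    ∑ k ∈ Finset.range n,
      A n (fun j => s ((n - k + j.val) % n)) (fun j => x ((n - k + j.val) % n)) = 0 := by
  set f : ℕ → ℚ := fun i => A n (fun j => s ((i + j.val) % n)) (fun j => x ((i + j.val) % n))
    with hf
  have hper : Function.Periodic f n := fun i => by
    simp only [hf, show ∀ j, i + n + j = i + j + n by intros; omega, Nat.add_mod_right]
  have h0 : ∑ i ∈ Finset.range n, f i = 0 := by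
    rw [← hA n hn (fun j => s j.val) (fun j => x j.val)]
    refine Finset.sum_congr rfl fun i _ => ?_
    simp only [extQ_apply _ (Nat.mod_lt _ hn), extG_apply _ (Nat.mod_lt _ hn), hf]
  rw [← h0, ← sum_range_add_of_periodic hper 1, ← Finset.sum_range_reflect (fun k => f (k + 1))]
  refine Finset.sum_congr rfl fun k hk => ?_
  have hk := Finset.mem_range.mp hk
  rw [show n - 1 - k + 1 = n - k by omega]

/-- The contributions of all rotations with a fixed length of the contracted block cancel. -/
theorem IsPusNeutral.sum_contract_eq_zero {A : Mould Γ} (hA : IsPusNeutral A) {m n d : ℕ}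
    (hn : 1 ≤ n) (hm : m = n + (d + 1)) {s g : ℕ → Γ} {x z C : ℕ → ℚ}
    (hs : Function.Periodic s m) (hg : Function.Periodic g m) (hx : Function.Periodic x m)
    (hz : Function.Periodic z m) (hC : Function.Periodic C m) :
    ∑ i ∈ Finset.range m, ∑ k ∈ Finset.range n,
      A n (fun j => contract k d (fun t => s (i + t)) (g (i + k)) j.val)
        (fun j => contract k d (fun t => x (i + t)) (z (i + k)) j.val) * C (i + k) = 0 := by
  rw [Finset.sum_comm]
  have key : ∀ k ∈ Finset.range n, ∑ i ∈ Finset.range m,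
      A n (fun j => contract k d (fun t => s (i + t)) (g (i + k)) j.val)
        (fun j => contract k d (fun t => x (i + t)) (z (i + k)) j.val) * C (i + k) =
      ∑ a ∈ Finset.range m,
        A n (fun j => (fun b => if b = 0 then g a else s (a + (d + 1) + b)) ((n - k + j.val) % n))
          (fun j => (fun b => if b = 0 then z a else x (a + (d + 1) + b)) ((n - k + j.val) % n)) *
          C a := by
    intro k hk
    have hk := Finset.mem_range.mp hk
    rw [← sum_range_add_of_periodic (m := m) (a := m - k)]
    · refine Finset.sum_congr rfl fun a _ => ?_
      have e : a + (m - k) + k = a + m := by omega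
      rw [e, hg, hz, hC]
      congr 2
      · funext j
        exact contract_rotate hs hm hk j.isLt a _
      · funext j
        exact contract_rotate hx hm hk j.isLt a _
    · intro i
      have e : ∀ t, i + m + t = i + t + m := by intros; omega
      simp only [e, hs _, hg _, hx _, hz _, hC _]
  rw [Finset.sum_congr rfl key, Finset.sum_comm]
  refine Finset.sum_eq_zero fun a _ => ?_
  have h := hA.sum_eq_zero hn (fun b => if b = 0 then g a else s (a + (d + 1) + b))
    (fun b => if b = 0 then z a else x (a + (d + 1) + b))
  rw [← Finset.sum_mul, h, zero_mul]

theorem mouldMul_apply (A B : Mould Γ) (m : ℕ) (s : ℕ → Γ) (x : ℕ → ℚ) :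
    mouldMul A B m (fun j => s j.val) (fun j => x j.val) =
      ∑ k ∈ Finset.range (m + 1), A k (fun j => s j.val) (fun j => x j.val) *
        B (m - k) (fun j => s (k + j.val)) (fun j => x (k + j.val)) := by
  refine Finset.sum_congr rfl fun k hk => ?_
  have hk := Finset.mem_range.mp hk
  congr 2 <;> funext j <;> have := j.isLt
  · exact extG_apply _ (by omega)
  · exact extQ_apply _ (by omega)
  · exact extG_apply _ (by omega)
  · exact extQ_apply _ (by omega)

theorem aritV_apply (A B : Mould Γ) (m : ℕ) (s : ℕ → Γ) (x : ℕ → ℚ) :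
    aritV B A m (fun j => s j.val) (fun j => x j.val) =
      (∑ d ∈ Finset.range (m - 1), ∑ k ∈ Finset.range (m - (d + 1)),
        A (m - (d + 1))
          (fun j => contract k d s (∏ t ∈ Finset.range (d + 2), s (k + t)) j.val)
          (fun j => contract k d x (x (k + (d + 1))) j.val) *
        B (d + 1) (fun j => s (k + j.val)) (fun j => x (k + j.val) - x (k + (d + 1)))) -
      ∑ d ∈ Finset.range (m - 1), ∑ k ∈ Finset.range (m - (d + 1)),
        A (m - (d + 1))
          (fun j => contract k d s (∏ t ∈ Finset.range (d + 2), s (k + t)) j.val)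
          (fun j => contract k d x (x k) j.val) *
        B (d + 1) (fun j => s (k + (1 + j.val))) (fun j => x (k + (1 + j.val)) - x k) := by
  have hprod : ∀ k d, k + d + 1 < m →
      ∏ i ∈ Finset.Icc k (k + d + 1), extG (fun j : Fin m => s j.val) i =
        ∏ t ∈ Finset.range (d + 2), s (k + t) := by
    intro k d h
    rw [← Finset.Ico_add_one_right_eq_Icc, Finset.prod_Ico_eq_prod_range,
      show k + d + 1 + 1 - k = d + 2 by omega]
    refine Finset.prod_congr rfl fun t ht => ?_
    have ht := Finset.mem_range.mp ht
    exact extG_apply _ (by omega)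
  unfold aritV
  rw [sum_intervals_init, sum_intervals_tail]
  congr 1 <;> refine Finset.sum_congr rfl fun d hd => Finset.sum_congr rfl fun k hk => ?_ <;>
    have hd := Finset.mem_range.mp hd <;> have hk := Finset.mem_range.mp hk
  · rw [show k + d - k = d by omega, hprod k d (by omega), extQ_apply x (by omega : k + d + 1 < m)]
    congr 2 <;> funext j <;> have := j.isLt
    · simp only [contract]
      split_ifs
      · exact extG_apply _ (by omega)
      · rfl
      · exact extG_apply _ (by omega)
    · simp only [contract]
      split_ifs
      · exact extQ_apply _ (by omega)
      · rfl
      · exact extQ_apply _ (by omega)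
    · exact extG_apply _ (by omega)
    · rw [extQ_apply _ (by omega)]
      rfl
  · rw [show k + 1 + d - (k + 1) = d by omega, show k + 1 - 1 = k by omega,
      show k + 1 + d = k + d + 1 by omega, hprod k d (by omega),
      extQ_apply x (by omega : k < m)]
    congr 2 <;> funext j <;> have := j.isLt
    · simp only [contract]
      split_ifs
      · exact extG_apply _ (by omega)
      · rfl
      · exact extG_apply _ (by omega)
    · simp only [contract]
      split_ifs
      · exact extQ_apply _ (by omega)
      · rfl
      · exact extQ_apply _ (by omega)
    · rw [add_assoc]
      exact extG_apply _ (by omega)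
    · rw [add_assoc, extQ_apply _ (by omega)]

/-- The cyclic sums of `A × B` and `B × A` agree. -/
theorem sum_rotate_mouldMul_comm (A B : Mould Γ) {m : ℕ} {s : ℕ → Γ} {x : ℕ → ℚ}
    (hs : Function.Periodic s m) (hx : Function.Periodic x m) :
    ∑ i ∈ Finset.range m, mouldMul A B m (fun j => s (i + j.val)) (fun j => x (i + j.val)) =
      ∑ i ∈ Finset.range m, mouldMul B A m (fun j => s (i + j.val)) (fun j => x (i + j.val)) := by
  have hmul : ∀ (M N : Mould Γ) (i : ℕ),
      mouldMul M N m (fun j => s (i + j.val)) (fun j => x (i + j.val)) = _ := fun M N i =>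
    mouldMul_apply M N m (fun t => s (i + t)) (fun t => x (i + t))
  simp only [hmul]
  rw [Finset.sum_comm, Finset.sum_comm (s := Finset.range m) (t := Finset.range (m + 1)),
    ← Finset.sum_range_reflect]
  refine Finset.sum_congr rfl fun k hk => ?_
  have hk := Finset.mem_range.mp hk
  have hadd : ∀ i t, i + m + t = i + t + m := by intros; omega
  rw [← sum_range_add_of_periodic (m := m) (a := k)]
  · refine Finset.sum_congr rfl fun i _ => ?_
    rw [show m + 1 - 1 - k = m - k by omega, show m - (m - k) = k by omega, mul_comm]
    have e : ∀ t, i + k + (m - k + t) = i + t + m := by intros; omega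
    simp only [e, hs _, hx _]
    simp only [add_assoc]
  · intro i
    simp only [hadd, hs _, hx _]

/-- `arit_v(B)` preserves pus-neutrality, for every mould `B`. -/
theorem IsPusNeutral.aritV {A : Mould Γ} (hA : IsPusNeutral A) (B : Mould Γ) {m : ℕ}
    {s : ℕ → Γ} {x : ℕ → ℚ} (hs : Function.Periodic s m) (hx : Function.Periodic x m) :
    ∑ i ∈ Finset.range m,
      KVMould.aritV B A m (fun j => s (i + j.val)) (fun j => x (i + j.val)) = 0 := by
  have hadd : ∀ i t, i + m + t = i + t + m := by intros; omega
  have harit : ∀ i : ℕ,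
      KVMould.aritV B A m (fun j => s (i + j.val)) (fun j => x (i + j.val)) = _ := fun i =>
    aritV_apply A B m (fun t => s (i + t)) (fun t => x (i + t))
  simp only [harit]
  rw [Finset.sum_sub_distrib, Finset.sum_comm,
    Finset.sum_comm (s := Finset.range m) (t := Finset.range (m - 1)),
    Finset.sum_eq_zero, Finset.sum_eq_zero, sub_zero]
  all_goals
    intro d hd
    have hd := Finset.mem_range.mp hd
    simp only [← add_assoc]
  · have h := hA.sum_contract_eq_zero (m := m) (n := m - (d + 1)) (d := d) (by omega) (by omega)
      (s := s) (g := fun a => ∏ t ∈ Finset.range (d + 2), s (a + t)) (x := x) (z := x)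
      (C := fun a => B (d + 1) (fun j => s (a + 1 + j.val)) (fun j => x (a + 1 + j.val) - x a))
      hs (fun a => by simp only [hadd, hs _]) hx hx
      (fun a => by simp only [hadd, hs _, hx _])
    exact h
  · have h := hA.sum_contract_eq_zero (m := m) (n := m - (d + 1)) (d := d) (by omega) (by omega)
      (s := s) (g := fun a => ∏ t ∈ Finset.range (d + 2), s (a + t)) (x := x)
      (z := fun a => x (a + d + 1))
      (C := fun a => B (d + 1) (fun j => s (a + j.val)) (fun j => x (a + j.val) - x (a + d + 1)))
      hs (fun a => by simp only [hadd, hs _]) hx (fun a => by simp only [hadd, hx _])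
      (fun a => by simp only [hadd, hs _, hx _])
    exact h

/-- Proposition: the `ari_v`-bracket of pus-neutral ARI moulds is pus-neutral. -/
theorem ariV_pusNeutral (Γ : Type) [CommGroup Γ] [Fintype Γ]
    (A B : Mould Γ) (hA : IsARI A) (hB : IsARI B)
    (hApn : IsPusNeutral A) (hBpn : IsPusNeutral B) :
    IsPusNeutral (ariV A B) := by
  intro m _ σ v
  have hs : Function.Periodic (fun a => extG σ (a % m)) m := fun a => by
    simp only [Nat.add_mod_right]
  have hx : Function.Periodic (fun a => extQ v (a % m)) m := fun a => by
    simp only [Nat.add_mod_right]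
  have hAB := hApn.aritV B hs hx
  have hBA := hBpn.aritV A hs hx
  have hmul := sum_rotate_mouldMul_comm A B hs hx
  simp only [ariV, Pi.add_apply, Pi.sub_apply, Finset.sum_sub_distrib, Finset.sum_add_distrib]
  linarith

end KVMould
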